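/- If a Boolean function family (f_n)_{n∈ℕ} is PLSIS-complete and (f_n)_{n∈ℕ} belongs to PLIS, then PLSIS = PLIS. -/

import Mathlib

/-- Boolean register names: `inp i` is input register `in:(i+1)`,
`aux i` is auxiliary register `aux:(i+1)`, `out` is the output register. -/
inductive Reg where
  | inp : ℕ → Reg
  | aux : ℕ → Reg
  | out : Reg
deriving DecidableEq

/-- Basic instructions: register reads/writes, and (for splitting instruction
sequences) `split p` and `reply p` for Boolean parameters `p`. -/
inductive BInstr where
  | get : Reg → BInstr
  | set : Reg → Bool → BInstr
  | split : ℕ → BInstr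
  | reply : ℕ → BInstr
deriving DecidableEq

/-- Primitive instructions. -/
inductive PInstr where
  | plain : BInstr → PInstr
  | pos : BInstr → PInstr
  | neg : BInstr → PInstr
  | jump : ℕ → PInstr
  | halt : PInstr
deriving DecidableEq

abbrev RegState := Reg → Bool

/-- State change caused by processing a basic instruction. -/
def BInstr.effect : BInstr → RegState → RegState
  | .set r b, s => Function.update s r b
  | _, s => s

/-- Reply produced by processing a basic instruction. -/
def BInstr.rpl : BInstr → RegState → Bool
  | .get r, s => s r
  | .set _ b, _ => b
  | _, _ => false

def BInstr.isSplitReply : BInstr → Bool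
  | .split _ => true
  | .reply _ => true
  | _ => false

/-- Single-thread execution of an instruction sequence on Boolean registers;
`none` means deadlock, `some s` means termination in register state `s`.
(`split`/`reply` instructions make no sense here and deadlock.) -/
def exec : List PInstr → RegState → Option RegState
  | [], _ => none
  | .plain a :: X, s =>
      if a.isSplitReply then none else exec X (a.effect s)
  | .pos a :: X, s =>
      if a.isSplitReply then none
      else if a.rpl s then exec X (a.effect s) else exec (X.drop 1) (a.effect s)
  | .neg a :: X, s =>
      if a.isSplitReply then none
      else if a.rpl s then exec (X.drop 1) (a.effect s) else exec X (a.effect s)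
  | .jump 0 :: _, _ => none
  | .jump (l+1) :: X, s => exec (X.drop l) s
  | .halt :: _, s => some s
termination_by X _ => X.length
decreasing_by all_goals (simp only [List.length_drop, List.length_cons]; omega)

/-- Initial register state: input registers `in:1 .. in:n` contain
`b 0, ..., b (n-1)`; all other registers contain `false`. -/
def initState (n : ℕ) (b : Fin n → Bool) : RegState := fun r =>
  match r with
  | .inp i => if h : i < n then b ⟨i, h⟩ else false
  | _ => false

/-- `X` computes the `n`-ary Boolean function `f`: for every input, execution
terminates (does not deadlock) with the output register containing `f b`. -/
def Computes {n : ℕ} (f : (Fin n → Bool) → Bool) (X : List PInstr) : Prop :=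
  ∀ b : Fin n → Bool, ∃ s : RegState,
    exec X (initState n b) = some s ∧ s Reg.out = f b

/-- Basic instructions allowed in `IS_br`. -/
def BrBasic : BInstr → Prop
  | .get (.inp _) => True
  | .get (.aux _) => True
  | .set (.aux _) _ => True
  | .set .out _ => True
  | _ => False

/-- Basic instructions allowed in `IS_br^na`. -/
def NaBasic : BInstr → Prop
  | .get (.inp _) => True
  | .set .out _ => True
  | _ => False

def InstrBasicOK (P : BInstr → Prop) : PInstr → Prop
  | .plain a => P a
  | .pos a => P a
  | .neg a => P a
  | _ => True

/-- Membership of `IS_br` (non-empty, only allowed basic instructions). -/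
def ISbr (X : List PInstr) : Prop :=
  X ≠ [] ∧ ∀ u ∈ X, InstrBasicOK BrBasic u

/-- Membership of `IS_br^na`. -/
def ISbrna (X : List PInstr) : Prop :=
  X ≠ [] ∧ ∀ u ∈ X, InstrBasicOK NaBasic u

/-- The primitive instruction contains the basic instruction `out.set:false`. -/
def UsesOutSetFalse : PInstr → Prop
  | .plain (.set .out false) => True
  | .pos (.set .out false) => True
  | .neg (.set .out false) => True
  | _ => False

/-- The class PLIS of Boolean function families computable by
polynomial-length instruction sequences from `IS_br`. -/
def PLIS (F : (n : ℕ) → (Fin n → Bool) → Bool) : Prop :=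
  ∃ h : Polynomial ℕ, ∀ n : ℕ, ∃ X : List PInstr,
    ISbr X ∧ Computes (F n) X ∧ X.length ≤ h.eval n

/-- Basic instructions allowed in `SIS_br`. -/
def SisBasic : BInstr → Prop
  | .get (.inp _) => True
  | .set .out true => True
  | .split _ => True
  | .reply _ => True
  | _ => False

/-- Membership of `SIS_br`. -/
def SISbr (X : List PInstr) : Prop :=
  X ≠ [] ∧ ∀ u ∈ X, InstrBasicOK SisBasic u

/-- A (partial) instantiation of the Boolean parameters. -/
abbrev PEnv := ℕ → Option Bool

/-- Fueled cyclic-interleaving execution of a vector of threads (each a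
remaining instruction sequence with a parameter instantiation) sharing the
Boolean registers.  `none` means deadlock (or not enough fuel), `some s`
means successful termination of all threads in register state `s`. -/
def sexec : ℕ → List (List PInstr × PEnv) → RegState → Option RegState
  | 0, _, _ => none
  | _ + 1, [], s => some s
  | fuel + 1, (is, ρ) :: ts, s =>
    match is with
    | [] => none
    | .halt :: _ => sexec fuel ts s
    | .jump 0 :: _ => none
    | .jump (l+1) :: X => sexec fuel ((X.drop l, ρ) :: ts) s
    | .plain a :: X =>
      match a with
      | .split p =>
        match ρ p with
        | some _ => none
        | none => sexec fuel
            (ts ++ [(X, Function.update ρ p (some true)),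
                    (X, Function.update ρ p (some false))]) s
      | .reply p =>
        match ρ p with
        | none => none
        | some _ => sexec fuel (ts ++ [(X, ρ)]) s
      | _ => sexec fuel (ts ++ [(X, ρ)]) (a.effect s)
    | .pos a :: X =>
      match a with
      | .split p =>
        match ρ p with
        | some _ => none
        | none => sexec fuel
            (ts ++ [(X, Function.update ρ p (some true)),
                    (X.drop 1, Function.update ρ p (some false))]) s
      | .reply p =>
        match ρ p with
        | none => none
        | some b => sexec fuel (ts ++ [(if b then X else X.drop 1, ρ)]) s
      | _ => sexec fuel (ts ++ [(if a.rpl s then X else X.drop 1, ρ)]) (a.effect s)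
    | .neg a :: X =>
      match a with
      | .split p =>
        match ρ p with
        | some _ => none
        | none => sexec fuel
            (ts ++ [(X.drop 1, Function.update ρ p (some true)),
                    (X, Function.update ρ p (some false))]) s
      | .reply p =>
        match ρ p with
        | none => none
        | some b => sexec fuel (ts ++ [(if b then X.drop 1 else X, ρ)]) s
      | _ => sexec fuel (ts ++ [(if a.rpl s then X.drop 1 else X, ρ)]) (a.effect s)

/-- `X` splitting computes the `n`-ary Boolean function `f`. -/
def SplittingComputes {n : ℕ} (f : (Fin n → Bool) → Bool) (X : List PInstr) : Prop :=
  ∀ b : Fin n → Bool, ∃ (fuel : ℕ) (s : RegState),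
    sexec fuel [(X, fun _ => none)] (initState n b) = some s ∧ s Reg.out = f b

/-- The class PLSIS of Boolean function families splitting computable by
polynomial-length instruction sequences from `SIS_br`. -/
def PLSIS (F : (n : ℕ) → (Fin n → Bool) → Bool) : Prop :=
  ∃ h : Polynomial ℕ, ∀ n : ℕ, ∃ X : List PInstr,
    SISbr X ∧ SplittingComputes (F n) X ∧ X.length ≤ h.eval n

/-- `f` is length-`l` reducible to `g`. -/
def LengthRed (l : ℕ) {n m : ℕ} (f : (Fin n → Bool) → Bool)
    (g : (Fin m → Bool) → Bool) : Prop :=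
  ∃ h : Fin m → (Fin n → Bool) → Bool,
    (∀ j : Fin m, ∃ X : List PInstr, ISbr X ∧ Computes (h j) X ∧ X.length ≤ l) ∧
    ∀ b : Fin n → Bool, f b = g (fun j => h j b)

/-- Non-uniform polynomial-length reducibility of Boolean function families. -/
def PLRed (F G : (n : ℕ) → (Fin n → Bool) → Bool) : Prop :=
  ∃ q : Polynomial ℕ, ∀ n : ℕ, ∃ l m : ℕ,
    l ≤ q.eval n ∧ m ≤ q.eval n ∧ LengthRed l (F n) (G m)

/-- PLSIS-completeness. -/
def PLSISComplete (F : (n : ℕ) → (Fin n → Bool) → Bool) : Prop :=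
  PLSIS F ∧ ∀ G : (n : ℕ) → (Fin n → Bool) → Bool, PLSIS G → PLRed G F

/-- The basic instruction contained in a primitive instruction, if any. -/
def PInstr.basic? : PInstr → Option BInstr
  | .plain a => some a
  | .pos a => some a
  | .neg a => some a
  | _ => none

/-- The effect of a primitive instruction on the register state. -/
def PInstr.effect (u : PInstr) (s : RegState) : RegState :=
  match u.basic? with
  | some a => a.effect s
  | none => s

/-- The number of subsequent instructions skipped after a non-terminating instruction;
`none` means deadlock. -/
def PInstr.next : PInstr → RegState → Option ℕ
  | .plain a, _ => if a.isSplitReply then none else some 0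
  | .pos a, s => if a.isSplitReply then none else some (if a.rpl s then 0 else 1)
  | .neg a, s => if a.isSplitReply then none else some (if a.rpl s then 1 else 0)
  | .jump (l + 1), _ => some l
  | _, _ => none

theorem exec_cons {u : PInstr} (hu : u ≠ .halt) (X : List PInstr) (s : RegState) :
    exec (u :: X) s = (u.next s).bind fun j => exec (X.drop j) (u.effect s) := by
  rcases u with a | a | a | (_ | l) | _
  · rw [exec]; by_cases h : a.isSplitReply <;> simp [PInstr.next, PInstr.effect, PInstr.basic?, h]
  · rw [exec]
    by_cases h : a.isSplitReply <;> by_cases h' : a.rpl s <;>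
      simp [PInstr.next, PInstr.effect, PInstr.basic?, h, h']
  · rw [exec]
    by_cases h : a.isSplitReply <;> by_cases h' : a.rpl s <;>
      simp [PInstr.next, PInstr.effect, PInstr.basic?, h, h']
  · rw [exec]; simp [PInstr.next]
  · rw [exec]; simp [PInstr.next, PInstr.effect, PInstr.basic?]
  · exact absurd rfl hu

theorem exec_cons_eq_some {u : PInstr} (hu : u ≠ .halt) {X : List PInstr} {s s' : RegState}
    (h : exec (u :: X) s = some s') :
    ∃ j < X.length, u.next s = some j ∧ exec (X.drop j) (u.effect s) = some s' := by
  rw [exec_cons hu, Option.bind_eq_some_iff] at h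
  obtain ⟨j, hj, he⟩ := h
  refine ⟨j, ?_, hj, he⟩
  by_contra! hlt
  rw [List.drop_eq_nil_of_le hlt, exec] at he
  cases he

theorem Polynomial.eval_nat_mono (p : Polynomial ℕ) : Monotone fun n => p.eval n := by
  intro a b hab
  simp only [Polynomial.eval_eq_sum]
  exact Finset.sum_le_sum fun i _ => Nat.mul_le_mul_left _ (Nat.pow_le_pow_left hab i)

section Relocation

def BInstr.rename (φ : Reg → Reg) : BInstr → BInstr
  | .get r => .get (φ r)
  | .set r b => .set (φ r) b
  | a => a

/-- Rename the registers in an instruction; termination becomes a jump of length `n + 1`. -/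
def PInstr.relocate (φ : Reg → Reg) (n : ℕ) : PInstr → PInstr
  | .plain a => .plain (a.rename φ)
  | .pos a => .pos (a.rename φ)
  | .neg a => .neg (a.rename φ)
  | .jump l => .jump l
  | .halt => .jump (n + 1)

/-- Rename the registers in an instruction sequence and let it continue with the code placed
behind it instead of terminating. -/
def relocate (φ : Reg → Reg) : List PInstr → List PInstr
  | [] => []
  | u :: X => u.relocate φ X.length :: relocate φ X

@[simp] theorem length_relocate (φ : Reg → Reg) (X : List PInstr) :
    (relocate φ X).length = X.length := by
  induction X with
  | nil => rfl
  | cons u X ih => simp [relocate, ih]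

theorem drop_relocate (φ : Reg → Reg) (X : List PInstr) (j : ℕ) :
    (relocate φ X).drop j = relocate φ (X.drop j) := by
  induction X generalizing j with
  | nil => simp [relocate]
  | cons u X ih => cases j <;> simp [relocate, ih]

theorem rpl_rename {φ : Reg → Reg} {s t : RegState} (h : ∀ r, t (φ r) = s r) (a : BInstr) :
    (a.rename φ).rpl t = a.rpl s := by
  cases a <;> simp [BInstr.rename, BInstr.rpl, h]

theorem isSplitReply_rename (φ : Reg → Reg) (a : BInstr) :
    (a.rename φ).isSplitReply = a.isSplitReply := by
  cases a <;> rfl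

theorem next_relocate {φ : Reg → Reg} {s t : RegState} (h : ∀ r, t (φ r) = s r) {u : PInstr}
    (hu : u ≠ .halt) (n : ℕ) : (u.relocate φ n).next t = u.next s := by
  rcases u with a | a | a | (_ | l) | _ <;>
    simp_all [PInstr.relocate, PInstr.next, rpl_rename h, isSplitReply_rename]

theorem effect_rename {φ : Reg → Reg} (hφ : φ.Injective) {s t : RegState}
    (h : ∀ r, t (φ r) = s r) (a : BInstr) (r : Reg) :
    (a.rename φ).effect t (φ r) = a.effect s r := by
  cases a <;> simp [BInstr.rename, BInstr.effect, Function.update_apply, hφ.eq_iff, h]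

theorem effect_relocate {φ : Reg → Reg} (hφ : φ.Injective) {s t : RegState}
    (h : ∀ r, t (φ r) = s r) (u : PInstr) (n : ℕ) (r : Reg) :
    (u.relocate φ n).effect t (φ r) = u.effect s r := by
  cases u <;> simp [PInstr.relocate, PInstr.effect, PInstr.basic?, effect_rename hφ h, h]

theorem effect_rename_of_ne {φ : Reg → Reg} {a : BInstr} (ha : BrBasic a) (t : RegState) {q : Reg}
    (haux : ∀ i, q ≠ φ (.aux i)) (hout : q ≠ φ .out) : (a.rename φ).effect t q = t q := by
  rcases a with _ | ⟨_ | _ | _, _⟩ | _ | _ <;>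
    simp_all [BInstr.rename, BInstr.effect, BrBasic]

theorem effect_relocate_of_ne {φ : Reg → Reg} {u : PInstr} (hu : InstrBasicOK BrBasic u)
    (n : ℕ) (t : RegState) {q : Reg} (haux : ∀ i, q ≠ φ (.aux i)) (hout : q ≠ φ .out) :
    (u.relocate φ n).effect t q = t q := by
  cases u <;> simp only [PInstr.relocate, PInstr.effect, PInstr.basic?]
  all_goals exact effect_rename_of_ne hu t haux hout

theorem relocate_ne_halt (φ : Reg → Reg) (n : ℕ) (u : PInstr) : u.relocate φ n ≠ .halt := by
  cases u <;> simp [PInstr.relocate]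

theorem exec_relocate_append {φ : Reg → Reg} (hφ : φ.Injective) (Z X : List PInstr)
    {s s' t : RegState} (hX : ∀ u ∈ X, InstrBasicOK BrBasic u) (h : ∀ r, t (φ r) = s r)
    (he : exec X s = some s') :
    ∃ t', exec (relocate φ X ++ Z) t = exec Z t' ∧ (∀ r, t' (φ r) = s' r) ∧
      ∀ q, (∀ i, q ≠ φ (.aux i)) → q ≠ φ .out → t' q = t q := by
  induction hn : X.length using Nat.strong_induction_on generalizing X s t with
  | _ n ih =>
  rcases X with _ | ⟨u, X⟩
  · rw [exec] at he; cases he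
  by_cases hu : u = .halt
  · subst hu
    rw [exec] at he
    cases he
    refine ⟨t, ?_, h, fun _ _ _ => rfl⟩
    rw [relocate, List.cons_append, PInstr.relocate, exec]
    simp
  · obtain ⟨j, hj, hnext, he⟩ := exec_cons_eq_some hu he
    obtain ⟨t', h₁, h₂, h₃⟩ := ih (X.drop j).length (by simp at hn ⊢; omega) (X.drop j)
      (fun v hv => hX v (List.mem_cons_of_mem _ (List.mem_of_mem_drop hv)))
      (effect_relocate hφ h u X.length) he rfl
    refine ⟨t', ?_, h₂, fun q hq hq' => (h₃ q hq hq').trans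
      (effect_relocate_of_ne (hX u List.mem_cons_self) _ t hq hq')⟩
    rw [relocate, List.cons_append, exec_cons (relocate_ne_halt φ _ u), next_relocate h hu, hnext,
      Option.bind_some, List.drop_append_of_le_length (by simp; omega), drop_relocate, h₁]

theorem brBasic_relocate {φ : Reg → Reg}
    (hin : ∀ i, BrBasic (.get (φ (.inp i)))) (hget : ∀ i, BrBasic (.get (φ (.aux i))))
    (hset : ∀ i b, BrBasic (.set (φ (.aux i)) b)) (hout : ∀ b, BrBasic (.set (φ .out) b))
    {X : List PInstr} (hX : ∀ u ∈ X, InstrBasicOK BrBasic u) :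
    ∀ u ∈ relocate φ X, InstrBasicOK BrBasic u := by
  induction X with
  | nil => simp [relocate]
  | cons v X ih =>
    intro u hu
    rw [relocate, List.mem_cons] at hu
    rcases hu with rfl | hu
    · have hv := hX v List.mem_cons_self
      have key : ∀ a, BrBasic a → BrBasic (a.rename φ) := by
        rintro (⟨_ | _ | _⟩ | ⟨_ | _ | _, _⟩ | _ | _) ha
        exacts [hin _, hget _, ha.elim, ha.elim, hset _ _, hout _, ha.elim, ha.elim]
      cases v <;> first | exact key _ hv | trivial
    · exact ih (fun w hw => hX w (List.mem_cons_of_mem _ hw)) u hu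

end Relocation

section Composition

/-- Register layout of the `j`-th inner instruction sequence of a composition. -/
def innerReg (j : ℕ) : Reg → Reg
  | .inp i => .inp i
  | .aux i => .aux (Nat.pair (j + 1) (i + 1))
  | .out => .aux (Nat.pair (j + 1) 0)

/-- Register layout of the outer instruction sequence of a composition. -/
def outerReg : Reg → Reg
  | .inp j => .aux (Nat.pair (j + 1) 0)
  | .aux i => .aux (Nat.pair 0 i)
  | .out => .out

theorem innerReg_injective (j : ℕ) : (innerReg j).Injective := by
  intro a b h
  cases a <;> cases b <;> simp_all [innerReg, Nat.pair_eq_pair]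

theorem outerReg_injective : outerReg.Injective := by
  intro a b h
  cases a <;> cases b <;> simp_all [outerReg, Nat.pair_eq_pair]

def innerCode {m : ℕ} (X : Fin m → List PInstr) (l : List (Fin m)) : List PInstr :=
  l.flatMap fun j : Fin m => relocate (innerReg j) (X j)

theorem exec_innerCode_append {n m : ℕ} {h : Fin m → (Fin n → Bool) → Bool}
    {X : Fin m → List PInstr} (hX : ∀ j, ISbr (X j)) (hc : ∀ j, Computes (h j) (X j))
    (b : Fin n → Bool) (Z : List PInstr) {l : List (Fin m)} (hl : l.Nodup) {t : RegState}
    (hin : ∀ i, t (.inp i) = initState n b (.inp i))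
    (haux : ∀ j ∈ l, ∀ i, t (.aux (Nat.pair (j + 1) i)) = false) :
    ∃ t', exec (innerCode X l ++ Z) t = exec Z t' ∧
      (∀ j ∈ l, t' (.aux (Nat.pair (j + 1) 0)) = h j b) ∧
      ∀ q, (∀ j ∈ l, ∀ i, q ≠ .aux (Nat.pair (j + 1) i)) → t' q = t q := by
  induction l generalizing t with
  | nil => exact ⟨t, by simp [innerCode], by simp, fun _ _ => rfl⟩
  | cons j l ih =>
    obtain ⟨hjl, hl⟩ := List.nodup_cons.1 hl
    obtain ⟨s, hs, hsout⟩ := hc j b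
    obtain ⟨t₁, h₁, h₂, h₃⟩ := exec_relocate_append (innerReg_injective j) (innerCode X l ++ Z)
      (X j) (t := t) (hX j).2 (by
        rintro (i | i | _)
        · exact hin i
        · exact haux j List.mem_cons_self _
        · exact haux j List.mem_cons_self _) hs
    have h₃' : ∀ q, (∀ i, q ≠ .aux (Nat.pair (j + 1) i)) → t₁ q = t q :=
      fun q hq => h₃ q (fun i => hq _) (hq _)
    have hne : ∀ j' ∈ l, ∀ i i', Reg.aux (Nat.pair (j' + 1) i) ≠ .aux (Nat.pair (j + 1) i') := by
      intro j' hj' i i' he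
      simp only [Reg.aux.injEq, Nat.pair_eq_pair] at he
      exact hjl ((Fin.ext (by omega) : j' = j) ▸ hj')
    obtain ⟨t₂, h₄, h₅, h₆⟩ := ih hl (t := t₁) (fun i => by rw [h₃' _ (by simp), hin])
      (fun j' hj' i => by
        rw [h₃' _ (hne j' hj' i), haux j' (List.mem_cons_of_mem _ hj')])
    refine ⟨t₂, ?_, ?_, fun q hq => ?_⟩
    · rw [← h₄, ← h₁]
      simp [innerCode]
    · intro j' hj'
      rcases List.mem_cons.1 hj' with rfl | hj'
      · rw [h₆ _ fun j'' hj'' i => (hne j'' hj'' i 0).symm, ← hsout]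
        exact h₂ .out
      · exact h₅ j' hj'
    · rw [h₆ q fun j' hj' => hq j' (List.mem_cons_of_mem _ hj'), h₃' q (hq j List.mem_cons_self)]

theorem length_innerCode_le {m k : ℕ} {X : Fin m → List PInstr} (hX : ∀ j, (X j).length ≤ k)
    (l : List (Fin m)) : (innerCode X l).length ≤ l.length * k := by
  induction l with
  | nil => simp [innerCode]
  | cons j l ih =>
    have := hX j
    simp only [innerCode, List.flatMap_cons, List.length_append, length_relocate,
      List.length_cons] at ih ⊢
    linarith

theorem exists_computes_comp {n m k : ℕ} {f : (Fin n → Bool) → Bool} {g : (Fin m → Bool) → Bool}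
    (hred : LengthRed k f g) {Y : List PInstr} (hY : ISbr Y) (hYc : Computes g Y) :
    ∃ X, ISbr X ∧ Computes f X ∧ X.length ≤ m * k + (Y.length + 1) := by
  obtain ⟨h, hh, hf⟩ := hred
  choose X hX hXc hXl using hh
  refine ⟨innerCode X (List.finRange m) ++ (relocate outerReg Y ++ [.halt]),
    ⟨by simp, ?_⟩, fun b => ?_, ?_⟩
  · intro u hu
    simp only [List.mem_append, List.mem_singleton, innerCode, List.mem_flatMap] at hu
    rcases hu with ⟨j, -, hu⟩ | hu | rfl
    · exact brBasic_relocate (by simp [innerReg, BrBasic]) (by simp [innerReg, BrBasic])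
        (by simp [innerReg, BrBasic]) (by simp [innerReg, BrBasic]) (hX j).2 u hu
    · exact brBasic_relocate (by simp [outerReg, BrBasic]) (by simp [outerReg, BrBasic])
        (by simp [outerReg, BrBasic]) (by simp [outerReg, BrBasic]) hY.2 u hu
    · trivial
  · obtain ⟨t, h₁, h₂, h₃⟩ := exec_innerCode_append hX hXc b (relocate outerReg Y ++ [.halt])
      (List.nodup_finRange m) (t := initState n b) (fun _ => rfl) (fun _ _ _ => rfl)
    obtain ⟨s, hs, hsout⟩ := hYc fun j => h j b
    obtain ⟨t', h₄, h₅, -⟩ := exec_relocate_append outerReg_injective [.halt] Y (t := t) hY.2 (by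
      rintro (j | i | _)
      · by_cases hj : j < m
        · simpa [initState, outerReg, hj] using h₂ ⟨j, hj⟩ (List.mem_finRange _)
        · rw [outerReg, h₃]
          · simp [initState, hj]
          · intro j' _ i he
            simp only [Reg.aux.injEq, Nat.pair_eq_pair] at he
            omega
      · rw [outerReg, h₃]
        · rfl
        · simp [Nat.pair_eq_pair]
      · rw [outerReg, h₃]
        · rfl
        · simp) hs
    refine ⟨t', ?_, ?_⟩
    · rw [h₁, h₄, exec]
    · rw [hf, ← hsout]
      exact h₅ .out
  · have := length_innerCode_le hXl (List.finRange m)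
    simp only [List.length_finRange] at this
    simp only [List.length_append, length_relocate, List.length_singleton]
    omega

theorem PLIS.of_plRed {F G : (n : ℕ) → (Fin n → Bool) → Bool} (hGF : PLRed G F) (hF : PLIS F) :
    PLIS G := by
  obtain ⟨q, hq⟩ := hGF
  obtain ⟨h, hh⟩ := hF
  refine ⟨q * q + (h.comp q + 1), fun n => ?_⟩
  obtain ⟨k, m, hk, hm, hred⟩ := hq n
  obtain ⟨Y, hY, hYc, hYl⟩ := hh m
  obtain ⟨X, hX, hXc, hXl⟩ := exists_computes_comp hred hY hYc
  refine ⟨X, hX, hXc, hXl.trans ?_⟩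
  simp only [Polynomial.eval_add, Polynomial.eval_mul, Polynomial.eval_comp, Polynomial.eval_one]
  exact Nat.add_le_add (Nat.mul_le_mul hm hk)
    (Nat.add_le_add_right (hYl.trans (Polynomial.eval_nat_mono h hm)) 1)

end Composition

section Threads

/-- `ThreadEval σ X ρ o`: on inputs `σ`, the thread `X` with parameter instantiation `ρ` and all
threads split off from it terminate; `o` tells whether one of them sets the output register. -/
inductive ThreadEval (σ : ℕ → Bool) : List PInstr → PEnv → Bool → Prop
  | halt (X : List PInstr) (ρ : PEnv) : ThreadEval σ (.halt :: X) ρ false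
  | jump {X : List PInstr} {ρ : PEnv} {o : Bool} (l : ℕ) :
      ThreadEval σ (X.drop l) ρ o → ThreadEval σ (.jump (l + 1) :: X) ρ o
  | setOut {X : List PInstr} {ρ : PEnv} {o : Bool} :
      ThreadEval σ X ρ o → ThreadEval σ (.plain (.set .out true) :: X) ρ true
  | posGet {X : List PInstr} {ρ : PEnv} {o : Bool} (i : ℕ) :
      ThreadEval σ (if σ i then X else X.drop 1) ρ o →
      ThreadEval σ (.pos (.get (.inp i)) :: X) ρ o
  | posReply {X : List PInstr} {ρ : PEnv} {o b : Bool} {p : ℕ} : ρ p = some b →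
      ThreadEval σ (if b then X else X.drop 1) ρ o → ThreadEval σ (.pos (.reply p) :: X) ρ o
  | posSplit {X : List PInstr} {ρ : PEnv} {o o₂ : Bool} {p : ℕ} : ρ p = none →
      ThreadEval σ X (Function.update ρ p (some true)) o →
      ThreadEval σ (X.drop 1) (Function.update ρ p (some false)) o₂ →
      ThreadEval σ (.pos (.split p) :: X) ρ (o || o₂)
  | negSplit {X : List PInstr} {ρ : PEnv} {o o₂ : Bool} {p : ℕ} : ρ p = none →
      ThreadEval σ (X.drop 1) (Function.update ρ p (some true)) o →
      ThreadEval σ X (Function.update ρ p (some false)) o₂ →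
      ThreadEval σ (.neg (.split p) :: X) ρ (o || o₂)

/-- An upper bound on the number of steps of a vector of threads. -/
def threadsWeight (ts : List ((List PInstr × PEnv) × Bool)) : ℕ :=
  (ts.map fun x => 3 ^ x.1.1.length).sum

theorem exists_sexec_eq_some (σ : ℕ → Bool) (ts : List ((List PInstr × PEnv) × Bool))
    (hts : ∀ x ∈ ts, ThreadEval σ x.1.1 x.1.2 x.2) (s : RegState) (hs : ∀ i, s (.inp i) = σ i) :
    ∃ fuel s', sexec fuel (ts.map Prod.fst) s = some s' ∧
      s' .out = (s .out || ts.any Prod.snd) := by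
  induction hn : threadsWeight ts using Nat.strong_induction_on generalizing ts s with
  | _ N ih =>
  rcases ts with _ | ⟨⟨⟨X, ρ⟩, o⟩, ts⟩
  · exact ⟨1, s, rfl, by simp⟩
  have hpow : ∀ (Y Z : List PInstr), Y.length ≤ Z.length → 3 ^ Y.length ≤ 3 ^ Z.length :=
    fun Y Z h => Nat.pow_le_pow_right (by norm_num) h
  have hX := hts _ List.mem_cons_self
  have hts' := fun x hx => hts x (List.mem_cons_of_mem _ hx)
  simp only at hX
  cases hX with
  | halt X ρ =>
    have h0 : 0 < 3 ^ (PInstr.halt :: X).length := by positivity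
    obtain ⟨fuel, s', h₁, h₂⟩ := ih (threadsWeight ts)
      (by simp only [threadsWeight, List.map_cons, List.sum_cons] at hn ⊢; omega) ts hts' s hs rfl
    exact ⟨fuel + 1, s', by simpa [sexec] using h₁, by simpa using h₂⟩
  | @jump X _ _ l h =>
    have h0 := hpow (X.drop l) X (by simp)
    have h1 : 0 < 3 ^ X.length := by positivity
    obtain ⟨fuel, s', h₁, h₂⟩ := ih (threadsWeight (((X.drop l, ρ), o) :: ts))
      (by
        simp only [threadsWeight, List.map_cons, List.sum_cons, List.length_cons, pow_succ]
          at hn ⊢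
        omega) (((X.drop l, ρ), o) :: ts)
      (List.forall_mem_cons.2 ⟨h, hts'⟩) s hs rfl
    exact ⟨fuel + 1, s', by simpa [sexec] using h₁, by simpa using h₂⟩
  | @setOut X _ o' h =>
    have h1 : 0 < 3 ^ X.length := by positivity
    obtain ⟨fuel, s', h₁, h₂⟩ := ih (threadsWeight (ts ++ [((X, ρ), o')]))
      (by
        simp only [threadsWeight, List.map_cons, List.map_append, List.map_nil, List.sum_nil,
          List.sum_append, List.sum_cons, List.length_cons, pow_succ] at hn ⊢
        omega) (ts ++ [((X, ρ), o')])
      (List.forall_mem_append.2 ⟨hts', by simpa using h⟩)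
      (Function.update s .out true) (by simpa using hs) rfl
    exact ⟨fuel + 1, s', by simpa [sexec, BInstr.effect] using h₁, by simpa using h₂⟩
  | @posGet X _ _ i h =>
    have h0 := hpow (if σ i then X else X.drop 1) X (by split <;> simp)
    have h1 : 0 < 3 ^ X.length := by positivity
    obtain ⟨fuel, s', h₁, h₂⟩ := ih
      (threadsWeight (ts ++ [((if σ i then X else X.drop 1, ρ), o)]))
      (by
        simp only [threadsWeight, List.map_cons, List.map_append, List.map_nil, List.sum_nil,
          List.sum_append, List.sum_cons, List.length_cons, pow_succ] at hn ⊢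
        omega) (ts ++ [((if σ i then X else X.drop 1, ρ), o)])
      (List.forall_mem_append.2 ⟨hts', by simpa using h⟩) s hs rfl
    exact ⟨fuel + 1, s', by simpa [sexec, BInstr.effect, BInstr.rpl, hs] using h₁,
      by simpa [Bool.or_comm, Bool.or_left_comm] using h₂⟩
  | @posReply X _ _ b p hp h =>
    have h0 := hpow (if b then X else X.drop 1) X (by split <;> simp)
    have h1 : 0 < 3 ^ X.length := by positivity
    obtain ⟨fuel, s', h₁, h₂⟩ := ih
      (threadsWeight (ts ++ [((if b then X else X.drop 1, ρ), o)]))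
      (by
        simp only [threadsWeight, List.map_cons, List.map_append, List.map_nil, List.sum_nil,
          List.sum_append, List.sum_cons, List.length_cons, pow_succ] at hn ⊢
        omega) (ts ++ [((if b then X else X.drop 1, ρ), o)])
      (List.forall_mem_append.2 ⟨hts', by simpa using h⟩) s hs rfl
    exact ⟨fuel + 1, s', by simpa [sexec, hp] using h₁,
      by simpa [Bool.or_comm, Bool.or_left_comm] using h₂⟩
  | @posSplit X _ o₁ o₂ p hp h h' =>
    have h0 := hpow (X.drop 1) X (by simp)
    have h1 : 0 < 3 ^ X.length := by positivity
    obtain ⟨fuel, s', h₁, h₂⟩ := ih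
      (threadsWeight (ts ++ [((X, Function.update ρ p (some true)), o₁),
        ((X.drop 1, Function.update ρ p (some false)), o₂)]))
      (by
        simp only [threadsWeight, List.map_cons, List.map_append, List.map_nil, List.sum_nil,
          List.sum_append, List.sum_cons, List.length_cons, pow_succ] at hn ⊢
        omega) (ts ++ [((X, Function.update ρ p (some true)), o₁),
        ((X.drop 1, Function.update ρ p (some false)), o₂)])
      (List.forall_mem_append.2 ⟨hts', by simpa using ⟨h, by simpa using h'⟩⟩) s hs rfl
    exact ⟨fuel + 1, s', by simpa [sexec, hp] using h₁,
      by simpa [Bool.or_comm, Bool.or_left_comm] using h₂⟩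
  | @negSplit X _ o₁ o₂ p hp h h' =>
    have h0 := hpow (X.drop 1) X (by simp)
    have h1 : 0 < 3 ^ X.length := by positivity
    obtain ⟨fuel, s', h₁, h₂⟩ := ih
      (threadsWeight (ts ++ [((X.drop 1, Function.update ρ p (some true)), o₁),
        ((X, Function.update ρ p (some false)), o₂)]))
      (by
        simp only [threadsWeight, List.map_cons, List.map_append, List.map_nil, List.sum_nil,
          List.sum_append, List.sum_cons, List.length_cons, pow_succ] at hn ⊢
        omega) (ts ++ [((X.drop 1, Function.update ρ p (some true)), o₁),
        ((X, Function.update ρ p (some false)), o₂)])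
      (List.forall_mem_append.2 ⟨hts', by simpa using ⟨by simpa using h, h'⟩⟩) s hs rfl
    exact ⟨fuel + 1, s', by simpa [sexec, hp] using h₁,
      by simpa [Bool.or_comm, Bool.or_left_comm] using h₂⟩

theorem splittingComputes_of_threadEval {n : ℕ} {f : (Fin n → Bool) → Bool} {X : List PInstr}
    (h : ∀ b, ThreadEval (fun i => initState n b (.inp i)) X (fun _ => none) (f b)) :
    SplittingComputes f X := by
  intro b
  obtain ⟨fuel, s, h₁, h₂⟩ := exists_sexec_eq_some _ [((X, fun _ => none), f b)]
    (by simpa using h b) (initState n b) fun _ => rfl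
  refine ⟨fuel, s, h₁, ?_⟩
  rw [h₂]
  simp [initState]

end Threads

section Compilation

def Reg.code : Reg → ℕ
  | .inp i => 2 * i + 1
  | .aux i => 2 * i + 2
  | .out => 0

theorem Reg.code_injective : Reg.code.Injective := by
  intro a b h
  cases a <;> cases b <;> simp_all [Reg.code] <;> omega

/-- The parameter holding the content of register `r` when `m` instructions remain. -/
def regParam (m : ℕ) (r : Reg) : ℕ := Nat.pair m r.code

theorem regParam_inj {m m' : ℕ} {r r' : Reg} :
    regParam m r = regParam m' r' ↔ m = m' ∧ r = r' := by
  simp [regParam, Nat.pair_eq_pair, Reg.code_injective.eq_iff]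

/-- `c` acts as a test instruction with reply `b`. -/
def IsTest (σ : ℕ → Bool) (c : PInstr) (ρ : PEnv) (b : Bool) : Prop :=
  ∀ Y o, ThreadEval σ (if b then Y else Y.drop 1) ρ o → ThreadEval σ (c :: Y) ρ o

def constTest (b : Bool) : PInstr := .jump (if b then 1 else 2)

theorem isTest_constTest (σ : ℕ → Bool) (ρ : PEnv) (b : Bool) :
    IsTest σ (constTest b) ρ b := by
  intro Y o h
  cases b
  · exact .jump 1 h
  · exact .jump 0 h

theorem isTest_reply (σ : ℕ → Bool) {ρ : PEnv} {b : Bool} {p : ℕ} (hp : ρ p = some b) :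
    IsTest σ (.pos (.reply p)) ρ b := fun _ _ h => .posReply hp h

/-- Instantiate the parameter `q` with the reply of the test `c`. -/
def assignCode (c : PInstr) (q : ℕ) : List PInstr :=
  [c, .jump 4, .pos (.split q), .halt, .jump 3, .neg (.split q), .halt]

theorem threadEval_assignCode {σ : ℕ → Bool} {c : PInstr} {ρ : PEnv} {b : Bool} {q : ℕ}
    (hc : IsTest σ c ρ b) (hq : ρ q = none) {Y : List PInstr} {o : Bool}
    (h : ThreadEval σ Y (Function.update ρ q (some b)) o) :
    ThreadEval σ (assignCode c q ++ Y) ρ o := by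
  refine hc _ _ ?_
  cases b
  · have := ThreadEval.posSplit (σ := σ) hq
      (.halt (.jump 3 :: .neg (.split q) :: .halt :: Y) _)
      (ThreadEval.jump (X := .neg (.split q) :: .halt :: Y) 2 h)
    simpa using this
  · have := ThreadEval.negSplit (X := .halt :: Y) hq h (.halt Y _)
    simpa using ThreadEval.jump (X := .pos (.split q) :: .halt :: .jump 3 ::
      .neg (.split q) :: .halt :: Y) 3 this

/-- Instantiate the parameters for position `m` of all registers in `R`. -/
def assignAll (c : Reg → PInstr) (m : ℕ) (R : List Reg) : List PInstr :=
  R.flatMap fun r => assignCode (c r) (regParam m r)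

@[simp] theorem length_assignAll (c : Reg → PInstr) (m : ℕ) (R : List Reg) :
    (assignAll c m R).length = 7 * R.length := by
  induction R with
  | nil => rfl
  | cons r R ih =>
    simp only [assignAll, List.flatMap_cons, List.length_append, List.length_cons] at ih ⊢
    rw [ih]
    simp [assignCode]
    omega

theorem threadEval_assignAll {σ : ℕ → Bool} {c : Reg → PInstr} {v : Reg → Bool} {m : ℕ}
    {R : List Reg} (hR : R.Nodup) {ρ : PEnv} (hnone : ∀ r ∈ R, ρ (regParam m r) = none)
    (hc : ∀ r ∈ R, ∀ ρ' : PEnv, (∀ q, (∀ r ∈ R, q ≠ regParam m r) → ρ' q = ρ q) →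
      IsTest σ (c r) ρ' (v r))
    {Y : List PInstr} {o : Bool}
    (h : ∀ ρ' : PEnv, (∀ q, (∀ r ∈ R, q ≠ regParam m r) → ρ' q = ρ q) →
      (∀ r ∈ R, ρ' (regParam m r) = some (v r)) → ThreadEval σ Y ρ' o) :
    ThreadEval σ (assignAll c m R ++ Y) ρ o := by
  induction R generalizing ρ with
  | nil => exact h ρ (fun _ _ => rfl) (by simp)
  | cons r R ih =>
    obtain ⟨hrR, hR⟩ := List.nodup_cons.1 hR
    have hne : ∀ r' ∈ R, regParam m r' ≠ regParam m r := by
      intro r' hr' he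
      exact hrR ((regParam_inj.1 he).2 ▸ hr')
    rw [assignAll, List.flatMap_cons, List.append_assoc]
    refine threadEval_assignCode (hc r List.mem_cons_self ρ fun _ _ => rfl)
      (hnone r List.mem_cons_self) ?_
    have hagree : ∀ ρ' : PEnv, (∀ q, (∀ r ∈ R, q ≠ regParam m r) →
        ρ' q = Function.update ρ (regParam m r) (some (v r)) q) →
        ∀ q, (∀ r' ∈ r :: R, q ≠ regParam m r') → ρ' q = ρ q := by
      intro ρ' hρ' q hq
      rw [hρ' q fun r' hr' => hq r' (List.mem_cons_of_mem _ hr'),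
        Function.update_of_ne (hq r List.mem_cons_self)]
    refine ih hR ?_ ?_ ?_
    · intro r' hr'
      rw [Function.update_of_ne (hne r' hr'), hnone r' (List.mem_cons_of_mem _ hr')]
    · exact fun r' hr' ρ' hρ' => hc r' (List.mem_cons_of_mem _ hr') ρ' (hagree ρ' hρ')
    · refine fun ρ' hρ' hv => h ρ' (hagree ρ' hρ') (List.forall_mem_cons.2 ⟨?_, hv⟩)
      rw [hρ' _ fun r' hr' => (hne r' hr').symm, Function.update_self]

/-- The test that decides where execution continues after an instruction. -/
def branchTest (m : ℕ) (u : PInstr) : PInstr :=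
  match u with
  | .pos (.get r) | .neg (.get r) => .pos (.reply (regParam m r))
  | .pos (.set _ b) | .neg (.set _ b) => constTest b
  | _ => constTest true

def branchReply (u : PInstr) (s : RegState) : Bool :=
  match u with
  | .pos a | .neg a => a.rpl s
  | _ => true

def trueTarget : PInstr → ℕ
  | .neg _ => 1
  | .jump l => l - 1
  | _ => 0

def falseTarget : PInstr → ℕ
  | .pos _ => 1
  | _ => 0

theorem next_eq_target {u : PInstr} {s : RegState} {j : ℕ} (h : u.next s = some j) :
    j = if branchReply u s then trueTarget u else falseTarget u := by
  rcases u with a | a | a | (_ | l) | _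
  · simp_all [PInstr.next, branchReply, trueTarget]
  · cases hr : a.rpl s <;> simp_all [PInstr.next, branchReply, trueTarget, falseTarget]
  · cases hr : a.rpl s <;> simp_all [PInstr.next, branchReply, trueTarget, falseTarget]
  all_goals simp_all [PInstr.next, branchReply, trueTarget]

/-- The test whose reply is the content of register `r` after an instruction. -/
def updateTest (m : ℕ) (u : PInstr) (r : Reg) : PInstr :=
  match u.basic? with
  | some (.set r' b) => if r = r' then constTest b else .pos (.reply (regParam m r))
  | _ => .pos (.reply (regParam m r))

def PInstr.regs (u : PInstr) : List Reg :=
  match u.basic? with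
  | some (.get r) => [r]
  | some (.set r _) => [r]
  | _ => []

theorem isTest_updateTest (σ : ℕ → Bool) {m : ℕ} (u : PInstr) {r : Reg} {ρ : PEnv} {s : RegState}
    (h : ρ (regParam m r) = some (s r)) : IsTest σ (updateTest m u r) ρ (u.effect s r) := by
  rw [updateTest, PInstr.effect]
  rcases u.basic? with _ | (_ | ⟨r', b⟩ | _ | _)
  · exact isTest_reply σ h
  · exact isTest_reply σ h
  · by_cases hr : r = r'
    · subst hr
      simpa [BInstr.effect] using isTest_constTest σ ρ b
    · simpa [BInstr.effect, hr] using isTest_reply σ h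
  · exact isTest_reply σ h
  · exact isTest_reply σ h

theorem isTest_branchTest (σ : ℕ → Bool) {m : ℕ} {u : PInstr} {ρ : PEnv} {s : RegState} {j : ℕ}
    (hu : u.next s = some j) (h : ∀ r ∈ u.regs, ρ (regParam m r) = some (s r)) :
    IsTest σ (branchTest m u) ρ (branchReply u s) := by
  rcases u with a | a | a | l | _
  · exact isTest_constTest σ ρ true
  · rcases a with r | ⟨r, b⟩ | p | p
    · exact isTest_reply σ (h r (by simp [PInstr.regs, PInstr.basic?]))
    · exact isTest_constTest σ ρ b
    · simp [PInstr.next, BInstr.isSplitReply] at hu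
    · simp [PInstr.next, BInstr.isSplitReply] at hu
  · rcases a with r | ⟨r, b⟩ | p | p
    · exact isTest_reply σ (h r (by simp [PInstr.regs, PInstr.basic?]))
    · exact isTest_constTest σ ρ b
    · simp [PInstr.next, BInstr.isSplitReply] at hu
    · simp [PInstr.next, BInstr.isSplitReply] at hu
  · exact isTest_constTest σ ρ true
  · exact isTest_constTest σ ρ true

def blockLength (R : List Reg) : ℕ := 14 * R.length + 4

/-- The code simulating a non-terminating instruction followed by `n` instructions. -/
def stepBlock (R : List Reg) (n : ℕ) (u : PInstr) : List PInstr :=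
  branchTest (n + 1) u :: .jump (7 * R.length + 2) ::
    (assignAll (updateTest (n + 1) u) (n - falseTarget u) R ++
      .jump (7 * R.length + 1 + falseTarget u * blockLength R + 1) ::
      (assignAll (updateTest (n + 1) u) (n - trueTarget u) R ++
        [.jump (trueTarget u * blockLength R + 1)]))

/-- The code simulating a termination instruction followed by `n` instructions. -/
def haltBlock (R : List Reg) (n : ℕ) : List PInstr :=
  .pos (.reply (regParam (n + 1) .out)) :: .plain (.set .out true) ::
    List.replicate (blockLength R - 2) .halt

/-- The code simulating an instruction sequence that uses the registers `R`. -/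
def compile (R : List Reg) : List PInstr → List PInstr
  | [] => []
  | u :: X => (if u = .halt then haltBlock R X.length else stepBlock R X.length u) ++ compile R X

theorem length_block (R : List Reg) (n : ℕ) (u : PInstr) :
    (if u = .halt then haltBlock R n else stepBlock R n u).length = blockLength R := by
  split
  · simp [haltBlock, blockLength]
  · simp [stepBlock, blockLength]
    omega

theorem length_compile (R : List Reg) (X : List PInstr) :
    (compile R X).length = X.length * blockLength R := by
  induction X with
  | nil => simp [compile]
  | cons u X ih => rw [compile, List.length_append, length_block, ih, List.length_cons]; ring

theorem drop_compile (R : List Reg) (X : List PInstr) (j : ℕ) :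
    (compile R X).drop (j * blockLength R) = compile R (X.drop j) := by
  induction X generalizing j with
  | nil => simp [compile]
  | cons u X ih =>
    cases j with
    | zero => simp
    | succ j =>
      rw [compile, List.drop_succ_cons, ← ih, List.drop_append, length_block,
        List.drop_eq_nil_of_le (by rw [length_block]; nlinarith), List.nil_append]
      congr 1
      rw [Nat.succ_mul]
      omega

theorem threadEval_transfer {σ : ℕ → Bool} {R : List Reg} (hR : R.Nodup) {X Z : List PInstr}
    {u : PInstr} {s : RegState} {ρ : PEnv} {o : Bool} {j k : ℕ}
    (hρ : ∀ r ∈ R, ρ (regParam (X.length + 1) r) = some (s r))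
    (hfresh : ∀ m ≤ X.length, ∀ r, ρ (regParam m r) = none)
    (hZ : Z.drop k = (compile R X).drop (j * blockLength R)) (hj : j < X.length)
    (ih : ∀ ρ' : PEnv, (∀ r ∈ R, ρ' (regParam (X.drop j).length r) = some (u.effect s r)) →
      (∀ m < (X.drop j).length, ∀ r, ρ' (regParam m r) = none) →
      ThreadEval σ (compile R (X.drop j)) ρ' o) :
    ThreadEval σ (assignAll (updateTest (X.length + 1) u) (X.length - j) R ++
      .jump (k + 1) :: Z) ρ o := by
  refine threadEval_assignAll hR (v := u.effect s) (fun r _ => hfresh _ (Nat.sub_le _ _) r) ?_ ?_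
  · intro r hr ρ' hρ'
    apply isTest_updateTest
    rw [hρ' _ fun r' _ he => by have := (regParam_inj.1 he).1; omega, hρ r hr]
  · intro ρ' hρ' hv
    refine .jump k ?_
    rw [hZ, drop_compile]
    refine ih ρ' (by simpa using hv) fun m hm r => ?_
    rw [List.length_drop] at hm
    rw [hρ' _ fun r' _ he => by have := (regParam_inj.1 he).1; omega, hfresh m (by omega)]

theorem threadEval_compile {σ : ℕ → Bool} {R : List Reg} (hR : R.Nodup) (hout : .out ∈ R)
    {X : List PInstr} (hX : ∀ u ∈ X, ∀ r ∈ u.regs, r ∈ R) {s s' : RegState} {ρ : PEnv}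
    (hρ : ∀ r ∈ R, ρ (regParam X.length r) = some (s r))
    (hfresh : ∀ m < X.length, ∀ r, ρ (regParam m r) = none) (he : exec X s = some s') :
    ThreadEval σ (compile R X) ρ (s' .out) := by
  induction hn : X.length using Nat.strong_induction_on generalizing X s ρ with
  | _ n ih =>
  rcases X with _ | ⟨u, X⟩
  · rw [exec] at he; cases he
  by_cases hu : u = .halt
  · subst hu
    rw [exec] at he
    cases he
    rw [compile, if_pos rfl, haltBlock, blockLength]
    refine .posReply (hρ .out hout) ?_
    cases s' .out
    · exact .halt _ _
    · exact .setOut (.halt _ _)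
  · obtain ⟨j, hj, hnext, he⟩ := exec_cons_eq_some hu he
    have hfresh' : ∀ m ≤ X.length, ∀ r, ρ (regParam m r) = none :=
      fun m hm => hfresh m (by simpa using Nat.lt_succ_of_le hm)
    have ih' := fun ρ' h₁ h₂ => ih (X.drop j).length (by simp at hn ⊢; omega) (X := X.drop j)
      (ρ := ρ') (fun v hv => hX v (List.mem_cons_of_mem _ (List.mem_of_mem_drop hv))) h₁ h₂ he rfl
    have hj' := next_eq_target hnext
    rw [compile, if_neg hu]
    simp only [stepBlock, List.cons_append, List.append_assoc, List.nil_append]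
    refine isTest_branchTest σ hnext (fun r hr => hρ r (hX u List.mem_cons_self r hr)) _ _ ?_
    cases hb : branchReply u s <;> simp only [hb, if_true, if_false, Bool.false_eq_true] at hj' ⊢
    · rw [← hj']
      refine threadEval_transfer hR hρ hfresh' ?_ hj ih'
      rw [Nat.add_assoc, ← List.drop_drop, ← length_assignAll (updateTest (X.length + 1) u)
        (X.length - trueTarget u), List.drop_left, Nat.add_comm, List.drop_succ_cons]
    · rw [← hj']
      refine .jump _ ?_
      rw [List.drop_append, List.drop_eq_nil_of_le (by simp)]
      simp only [length_assignAll, Nat.add_sub_cancel_left, List.drop_succ_cons, List.drop_zero,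
        List.nil_append]
      exact threadEval_transfer hR hρ hfresh' rfl hj ih'

theorem sisBasic_assignAll {c : Reg → PInstr} (hc : ∀ r, InstrBasicOK SisBasic (c r)) (m : ℕ)
    (R : List Reg) : ∀ v ∈ assignAll c m R, InstrBasicOK SisBasic v := by
  intro v hv
  simp only [assignAll, List.mem_flatMap, assignCode, List.mem_cons, List.not_mem_nil,
    or_false] at hv
  obtain ⟨r, -, rfl | rfl | rfl | rfl | rfl | rfl | rfl⟩ := hv
  · exact hc r
  all_goals trivial

theorem sisBasic_updateTest (m : ℕ) (u : PInstr) (r : Reg) :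
    InstrBasicOK SisBasic (updateTest m u r) := by
  unfold updateTest
  split
  · split <;> trivial
  · trivial

theorem sisBasic_branchTest (m : ℕ) (u : PInstr) : InstrBasicOK SisBasic (branchTest m u) := by
  unfold branchTest
  split <;> trivial

theorem sisBasic_compile (R : List Reg) (X : List PInstr) :
    ∀ v ∈ compile R X, InstrBasicOK SisBasic v := by
  induction X with
  | nil => simp [compile]
  | cons u X ih =>
    rw [compile]
    refine List.forall_mem_append.2 ⟨?_, ih⟩
    intro v hv
    split at hv
    · simp only [haltBlock, List.mem_cons, List.mem_replicate] at hv
      rcases hv with rfl | rfl | ⟨-, rfl⟩ <;> trivial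
    · simp only [stepBlock, List.mem_cons, List.mem_append, List.not_mem_nil, or_false] at hv
      rcases hv with rfl | rfl | hv | rfl | hv | rfl
      · exact sisBasic_branchTest _ _
      · trivial
      · exact sisBasic_assignAll (sisBasic_updateTest _ _) _ _ v hv
      · trivial
      · exact sisBasic_assignAll (sisBasic_updateTest _ _) _ _ v hv
      · trivial

/-- The test whose reply is the initial content of a register. -/
def initTest : Reg → PInstr
  | .inp i => .pos (.get (.inp i))
  | _ => constTest false

/-- The registers of `X`, together with the output register. -/
def usedRegs (X : List PInstr) : List Reg := (.out :: X.flatMap PInstr.regs).dedup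

theorem length_usedRegs_le (X : List PInstr) : (usedRegs X).length ≤ X.length + 1 := by
  refine (List.dedup_sublist _).length_le.trans ?_
  rw [List.length_cons, Nat.add_le_add_iff_right]
  induction X with
  | nil => simp
  | cons u X ih =>
    have : u.regs.length ≤ 1 := by
      unfold PInstr.regs
      split <;> simp
    simp only [List.flatMap_cons, List.length_append, List.length_cons]
    omega

/-- An instruction sequence that splitting computes what `X` computes. -/
def toSplitting (X : List PInstr) : List PInstr :=
  assignAll initTest X.length (usedRegs X) ++ compile (usedRegs X) X

theorem sisbr_toSplitting (X : List PInstr) : SISbr (toSplitting X) := by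
  constructor
  · have hout : Reg.out ∈ usedRegs X := by simp [usedRegs]
    rw [← List.length_pos_iff, toSplitting, List.length_append, length_assignAll]
    have := List.length_pos_of_mem hout
    omega
  · exact List.forall_mem_append.2
      ⟨sisBasic_assignAll (by rintro (_ | _ | _) <;> trivial) _ _, sisBasic_compile _ _⟩

theorem splittingComputes_toSplitting {n : ℕ} {f : (Fin n → Bool) → Bool} {X : List PInstr}
    (h : Computes f X) : SplittingComputes f (toSplitting X) := by
  refine splittingComputes_of_threadEval fun b => ?_
  obtain ⟨s, hs, hsout⟩ := h b
  rw [← hsout]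
  refine threadEval_assignAll (List.nodup_dedup _) (v := initState n b) (fun _ _ => rfl) ?_ ?_
  · rintro (i | i | _) _ ρ' _
    · exact fun Y o h => .posGet i h
    · exact isTest_constTest _ _ _
    · exact isTest_constTest _ _ _
  · intro ρ' hρ' hv
    refine threadEval_compile (List.nodup_dedup _) (by simp)
      (fun u hu r hr => ?_) hv (fun m hm r => ?_) hs
    · exact List.mem_dedup.2 (List.mem_cons_of_mem _ (List.mem_flatMap.2 ⟨u, hu, hr⟩))
    · exact hρ' _ fun r' _ he => by have := (regParam_inj.1 he).1; omega

theorem PLIS.plsis {G : (n : ℕ) → (Fin n → Bool) → Bool} (hG : PLIS G) : PLSIS G := by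
  obtain ⟨h, hh⟩ := hG
  refine ⟨7 * (h + 1) + h * (14 * (h + 1) + 4), fun n => ?_⟩
  obtain ⟨X, -, hXc, hXl⟩ := hh n
  refine ⟨toSplitting X, sisbr_toSplitting X, splittingComputes_toSplitting hXc, ?_⟩
  have hR : (usedRegs X).length ≤ h.eval n + 1 := (length_usedRegs_le X).trans (by omega)
  simp only [toSplitting, List.length_append, length_assignAll, length_compile, blockLength,
    Polynomial.eval_add, Polynomial.eval_mul, Polynomial.eval_one, Polynomial.eval_ofNat]
  gcongr

end Compilation

/-- Proposition 2.1 of the paper: if a PLSIS-complete family is in PLIS, then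
PLSIS = PLIS. -/
theorem statement10 (F : (n : ℕ) → (Fin n → Bool) → Bool)
    (hcomp : PLSISComplete F) (hF : PLIS F) :
    ∀ G : (n : ℕ) → (Fin n → Bool) → Bool, PLSIS G ↔ PLIS G :=
  fun G => ⟨fun hG => hF.of_plRed (hcomp.2 G hG), PLIS.plsis⟩
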